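/- For all integers n, m with 0 ≤ m ≤ n-2, the right-hand side Z_r of the ζ(4) identity satisfies the second-order linear recurrence a₀(n,m) Z_r(n,m) + a₁(n,m) Z_r(n,m+1) + a₂(n,m) Z_r(n,m+2) = 0, where a₀(n,m) = (2n-m)⁵, a₁(n,m) = -(4n-2m-1)(6n⁴-24n³m+22n²m²-8nm³+m⁴-24n³+30n²m-14nm²+2m³+8n²-10nm+2m²-4n+m), and a₂(n,m) = -(2n-m-1)³(4n-m)(m+2). -/

import Mathlib

open scoped BigOperators

/-- The Pochhammer symbol `(x)_k = x (x+1) ⋯ (x+k-1)` for a real `x`. -/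
noncomputable def poch (x : ℝ) (k : ℕ) : ℝ := ∏ i ∈ Finset.range k, (x + i)

/-- The rational function `R_{n,m}(t)` from the paper. -/
noncomputable def R (n m : ℕ) (t : ℝ) : ℝ :=
  (-1 : ℝ) ^ m * (t + n / 2) * (poch (t - n) m / m.factorial) *
    (poch (t - 2 * n + m) (2 * n - m) / (2 * n - m).factorial) *
    (poch (t + n + 1) n / poch t (n + 1)) *
    (poch (t + n + 1) (2 * n - m) / poch t (2 * n - m + 1)) *
    ((n.factorial : ℝ) / poch t (n + 1)) ^ 2

/-- The rational function `R̃_{n,m}(t)` from the paper. -/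
noncomputable def Rtilde (n m : ℕ) (t : ℝ) : ℝ :=
  ((n.factorial : ℝ) * poch (t - n) (2 * n - m) / (poch t (n + 1) * poch t (2 * n - m + 1))) *
    ∑ j ∈ Finset.range (n + 1),
      (n.choose j : ℝ) ^ 2 * ((2 * n - m + j).choose n : ℝ) * poch (t - j) n / n.factorial

/-- `Z_l(n,m) = -(1/3) Σ_{ν=n-m+1}^∞ (d/dt R_{n,m}(t))|_{t=ν}`. -/
noncomputable def Zl (n m : ℕ) : ℝ :=
  -(1 / 3) * ∑' ν : ℕ, deriv (R n m) ((n : ℝ) - m + 1 + ν)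

/-- `Z_r(n,m) = (1/6) Σ_{ν=1}^∞ (d²/dt² R̃_{n,m}(t))|_{t=ν}`. -/
noncomputable def Zr (n m : ℕ) : ℝ :=
  (1 / 6) * ∑' ν : ℕ, deriv (deriv (Rtilde n m)) (1 + (ν : ℝ))

/-- `U_k(n) = Σ_{i=0}^n C(4i,2i) / ((2i+1)^k C(2i,i)^8)`. -/
noncomputable def U (k n : ℕ) : ℝ :=
  ∑ i ∈ Finset.range (n + 1),
    ((4 * i).choose (2 * i) : ℝ) / ((2 * i + 1) ^ k * ((2 * i).choose i : ℝ) ^ 8)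

/-- The harmonic number `S₁(N) = Σ_{i=1}^N 1/i`. -/
noncomputable def S1 (N : ℕ) : ℝ := ∑ i ∈ Finset.range N, (1 : ℝ) / (i + 1)

open Polynomial

/-- The sum over `j` in the definition of `Rtilde`, without the factor `1 / n!`. -/
noncomputable def innerSum (n N : ℕ) (t : ℝ) : ℝ :=
  ∑ j ∈ Finset.range (n + 1), (n.choose j : ℝ) ^ 2 * ((N + j).choose n : ℝ) * poch (t - j) n

lemma poch_zero (x : ℝ) : poch x 0 = 1 := by simp [poch]

lemma poch_succ (x : ℝ) (k : ℕ) : poch x (k + 1) = poch x k * (x + k) := by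
  simp [poch, Finset.prod_range_succ]

lemma poch_succ_left (x : ℝ) (k : ℕ) : poch x (k + 1) = x * poch (x + 1) k := by
  simp only [poch, Finset.prod_range_succ', Nat.cast_zero, add_zero]
  rw [mul_comm]
  congr 1
  refine Finset.prod_congr rfl fun i _ => ?_
  push_cast
  ring

lemma poch_add (x : ℝ) (k l : ℕ) : poch x (k + l) = poch x k * poch (x + k) l := by
  simp only [poch, Finset.prod_range_add]
  congr 1
  refine Finset.prod_congr rfl fun i _ => ?_
  push_cast
  ring

lemma poch_pos {x : ℝ} (hx : 0 < x) (k : ℕ) : 0 < poch x k :=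
  Finset.prod_pos fun i _ => by positivity

/-- Leading recurrence coefficient, in terms of `N = 2 n - m`. -/
noncomputable def coeffZero (N : ℝ) : ℝ := N ^ 5

/-- Middle recurrence coefficient, in terms of `N = 2 n - m`. -/
noncomputable def coeffOne (n N : ℝ) : ℝ :=
  -(4 * n - 2 * (2 * n - N) - 1) *
    (6 * n ^ 4 - 24 * n ^ 3 * (2 * n - N) + 22 * n ^ 2 * (2 * n - N) ^ 2
      - 8 * n * (2 * n - N) ^ 3 + (2 * n - N) ^ 4 - 24 * n ^ 3
      + 30 * n ^ 2 * (2 * n - N) - 14 * n * (2 * n - N) ^ 2 + 2 * (2 * n - N) ^ 3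
      + 8 * n ^ 2 - 10 * n * (2 * n - N) + 2 * (2 * n - N) ^ 2 - 4 * n + (2 * n - N))

/-- Trailing recurrence coefficient, in terms of `N = 2 n - m`. -/
noncomputable def coeffTwo (n N : ℝ) : ℝ := -(N - 1) ^ 3 * (2 * n + N) * (2 * n - N + 2)

/-- Coefficient of the sum with parameter `N - 1` in the telescoping certificate. -/
noncomputable def certOne (n N t : ℝ) : ℝ :=
  (N ^ 3 - 2 * n + 4 * n * N - 2 * n ^ 2 + 4 * n ^ 2 * N) * (t + N - n - 2)

/-- Coefficient of the sum with parameter `N - 2` in the telescoping certificate. -/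
noncomputable def certTwo (n N t : ℝ) : ℝ :=
  -(N - 1) ^ 2 * (N * t + (N ^ 2 - N + 2 * n ^ 2 + 2 * n))

/-- Constant coefficient (in `j`) of the certificate for the summation over `j`. -/
noncomputable def certInnerZero (n N t : ℝ) : ℝ :=
  2 * N * t - N * t ^ 2 + 2 * N ^ 2 - 8 * N ^ 2 * t + 3 * N ^ 2 * t ^ 2 - 5 * N ^ 3
    + 9 * N ^ 3 * t - 2 * N ^ 3 * t ^ 2 + 4 * N ^ 4 - 3 * N ^ 4 * t - N ^ 5 + 4 * n * t
    - 2 * n * t ^ 2 + 4 * n * N - 13 * n * N * t + 5 * n * N * t ^ 2 - 7 * n * N ^ 2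
    + 9 * n * N ^ 2 * t - 2 * n * N ^ 2 * t ^ 2 + 3 * n * N ^ 3 + n * N ^ 3 * t
    - n * N ^ 3 * t ^ 2 - n * N ^ 4 * t + 10 * n ^ 2 * t - 4 * n ^ 2 * t ^ 2 + 10 * n ^ 2 * N
    - 33 * n ^ 2 * N * t + 10 * n ^ 2 * N * t ^ 2 - 19 * n ^ 2 * N ^ 2 + 26 * n ^ 2 * N ^ 2 * t
    - 4 * n ^ 2 * N ^ 2 * t ^ 2 + 11 * n ^ 2 * N ^ 3 - 5 * n ^ 2 * N ^ 3 * t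
    - 2 * n ^ 2 * N ^ 4 + 8 * n ^ 3 * t - 2 * n ^ 3 * t ^ 2 + 8 * n ^ 3 * N
    - 22 * n ^ 3 * N * t + 4 * n ^ 3 * N * t ^ 2 - 12 * n ^ 3 * N ^ 2 + 10 * n ^ 3 * N ^ 2 * t
    + 4 * n ^ 3 * N ^ 3 + 2 * n ^ 4 * t + 2 * n ^ 4 * N - 4 * n ^ 4 * N * t - 2 * n ^ 4 * N ^ 2

/-- Linear coefficient (in `j`) of the certificate for the summation over `j`. -/
noncomputable def certInnerOne (n N t : ℝ) : ℝ :=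
  -2 * N * t + N * t ^ 2 - 2 * N ^ 2 + 6 * N ^ 2 * t - 2 * N ^ 2 * t ^ 2 + 3 * N ^ 3
    - 3 * N ^ 3 * t - N ^ 4 - 4 * n * t + 2 * n * t ^ 2 - 4 * n * N + 11 * n * N * t
    - 4 * n * N * t ^ 2 + 5 * n * N ^ 2 - 4 * n * N ^ 2 * t - 3 * n * N ^ 3 + n * N ^ 3 * t
    + n * N ^ 4 - 6 * n ^ 2 * t + 2 * n ^ 2 * t ^ 2 - 6 * n ^ 2 * N + 16 * n ^ 2 * N * t
    - 4 * n ^ 2 * N * t ^ 2 + 8 * n ^ 2 * N ^ 2 - 6 * n ^ 2 * N ^ 2 * t - 3 * n ^ 2 * N ^ 3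
    - 2 * n ^ 3 * t - 2 * n ^ 3 * N + 4 * n ^ 3 * N * t + 2 * n ^ 3 * N ^ 2

lemma certificate_identity (n N t j : ℝ) :
    t ^ 2 * (t + N - n - 2) * (t - j + n) *
        (certOne n N (t + 1) * ((N + j - 1) * (N + j - n)) +
          certTwo n N (t + 1) * ((N + j - n) * (N + j - n - 1))) -
      (t - n - 1) * (t + n) * (t + N) * (t - j) *
        (certOne n N t * ((N + j - 1) * (N + j - n)) +
          certTwo n N t * ((N + j - n) * (N + j - n - 1))) -
      (t - j) * (coeffZero N * (t - n + N - 2) * (t - n + N - 1) * ((N + j) * (N + j - 1)) +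
        coeffOne n N * (t - n + N - 2) * (t + N) * ((N + j - 1) * (N + j - n)) +
        coeffTwo n N * (t + N - 1) * (t + N) * ((N + j - n) * (N + j - n - 1))) =
    (n - j) ^ 2 * (N + j - 1) * (t - j) * (certInnerZero n N t + certInnerOne n N t * (j + 1)) -
      j ^ 2 * (N + j - n) * (t - j + n) * (certInnerZero n N t + certInnerOne n N t * j) := by
  simp only [certOne, certTwo, certInnerZero, certInnerOne, coeffZero, coeffOne, coeffTwo]
  ring

/-- The combination of inner sums whose multiple by a hypergeometric term telescopes. -/
noncomputable def certSum (n K : ℕ) (t : ℝ) : ℝ :=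
  certOne n (K + 2) t * innerSum n (K + 1) t + certTwo n (K + 2) t * innerSum n K t

lemma innerSum_relation (n K : ℕ) (hn : 1 ≤ n) (hK : n ≤ K) (t : ℝ) :
    t ^ 2 * (t + K - n) * certSum n K (t + 1) -
      (t - n - 1) * (t + n) * (t + K + 2) * certSum n K t =
    coeffZero (K + 2) * (t - n + K) * (t - n + K + 1) * innerSum n (K + 2) t +
      coeffOne n (K + 2) * (t - n + K) * (t + K + 2) * innerSum n (K + 1) t +
      coeffTwo n (K + 2) * (t + K + 1) * (t + K + 2) * innerSum n K t := by
  obtain ⟨r, rfl⟩ : ∃ r, n = r + 1 := ⟨n - 1, by omega⟩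
  set n : ℕ := r + 1 with hn_def
  have hnr : (n : ℝ) = r + 1 := by simp [hn_def]
  have hKr : (n : ℝ) ≤ K := by exact_mod_cast hK
  let p : ℕ → ℝ := fun j => poch (t - j + 1) r
  let β : ℕ → ℝ := fun j => ((K + j).choose n : ℝ) / ((K + j + 1 - n) * (K + j + 2 - n))
  let H : ℕ → ℝ := fun j => (n.choose j : ℝ) ^ 2 * β j * p j * (j ^ 2 * ((K + 2) + j - n) *
    (t - j + n) * (certInnerZero n (K + 2) t + certInnerOne n (K + 2) t * j))
  have hp0 (j : ℕ) : poch (t - j) n = (t - j) * p j := by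
    rw [hn_def, poch_succ_left]
  have hp1 (j : ℕ) : poch (t + 1 - j) n = p j * (t - j + n) := by
    rw [hn_def, poch_succ, show t + 1 - (j : ℝ) = t - j + 1 by ring]
    push_cast
    ring
  have hp2 (j : ℕ) : p (j + 1) * (t - (j + 1) + n) = (t - j) * p j := by
    rw [← hp0 j, hn_def, poch_succ]
    simp only [p]
    push_cast
    rw [show t - ((j : ℝ) + 1) + 1 = t - j by ring]
    ring
  have hpos1 (j : ℕ) : (0 : ℝ) < K + j + 1 - n := by
    have : (0 : ℝ) ≤ j := j.cast_nonneg
    linarith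
  have hpos2 (j : ℕ) : (0 : ℝ) < K + j + 2 - n := by linarith [hpos1 j]
  have hβ0 (j : ℕ) : ((K + j).choose n : ℝ) = β j * ((K + j + 1 - n) * (K + j + 2 - n)) := by
    have h1 := (hpos1 j).ne'
    have h2 := (hpos2 j).ne'
    simp only [β]
    field_simp
  have hchoose (M : ℕ) (hM : n ≤ M + 1) :
      ((M + 1).choose n : ℝ) * (M + 1 - n) = (M + 1) * (M.choose n : ℝ) := by
    have h := Nat.choose_mul_succ_eq M n
    have h' : ((M.choose n * (M + 1) : ℕ) : ℝ) = ((M + 1).choose n * (M + 1 - n) : ℕ) := by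
      rw [h]
    rw [Nat.cast_mul, Nat.cast_mul, Nat.cast_sub hM] at h'
    push_cast at h'
    linarith
  have hβ1 (j : ℕ) : ((K + 1 + j).choose n : ℝ) = β j * ((K + 1 + j) * (K + j + 2 - n)) := by
    have h := hchoose (K + j) (by omega)
    rw [hβ0, show K + j + 1 = K + 1 + j by ring] at h
    apply mul_right_cancel₀ (hpos1 j).ne'
    push_cast at h
    linear_combination h
  have hβ2 (j : ℕ) : ((K + 2 + j).choose n : ℝ) = β j * ((K + 2 + j) * (K + 1 + j)) := by
    have h := hchoose (K + 1 + j) (by omega)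
    rw [hβ1, show K + 1 + j + 1 = K + 2 + j by ring] at h
    apply mul_right_cancel₀ (hpos2 j).ne'
    push_cast at h
    linear_combination h
  have hβs (j : ℕ) : β (j + 1) * ((K + 2) + (j + 1) - n) = β j * (K + 1 + j) := by
    have h := hβ0 (j + 1)
    rw [show K + (j + 1) = K + 1 + j by ring, hβ1] at h
    apply mul_right_cancel₀ (hpos2 j).ne'
    push_cast at h
    linear_combination -h
  have hcs (j : ℕ) : (n.choose (j + 1) : ℝ) ^ 2 * (j + 1) ^ 2 =
      (n.choose j : ℝ) ^ 2 * (n - j) ^ 2 := by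
    have h : (n.choose (j + 1) : ℝ) * (j + 1) = n.choose j * (n - j) := by
      rcases le_or_gt j n with hj | hj
      · have h := Nat.choose_succ_right_eq n j
        have h' : ((n.choose (j + 1) * (j + 1) : ℕ) : ℝ) = (n.choose j * (n - j) : ℕ) := by rw [h]
        rw [Nat.cast_mul, Nat.cast_mul, Nat.cast_sub hj] at h'
        exact_mod_cast h'
      · rw [Nat.choose_eq_zero_of_lt hj, Nat.choose_eq_zero_of_lt (by omega)]
        simp
    rw [← mul_pow, h, mul_pow]
  have hH (j : ℕ) : H (j + 1) = (n.choose j : ℝ) ^ 2 * β j * p j * ((n - j) ^ 2 *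
      ((K + 2) + j - 1) * (t - j) *
        (certInnerZero n (K + 2) t + certInnerOne n (K + 2) t * (j + 1))) := by
    simp only [H]
    push_cast
    calc _ = ((n.choose (j + 1) : ℝ) ^ 2 * (j + 1) ^ 2) * (β (j + 1) * ((K + 2) + (j + 1) - n)) *
          (p (j + 1) * (t - (j + 1) + n)) *
          (certInnerZero n (K + 2) t + certInnerOne n (K + 2) t * (j + 1)) := by ring
      _ = _ := by
        rw [hcs, hβs, hp2]
        ring
  have hsum : ∑ j ∈ Finset.range (n + 1), (H (j + 1) - H j) = 0 := by
    rw [Finset.sum_range_sub]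
    simp [H]
  rw [← sub_eq_zero, ← hsum]
  simp only [certSum, innerSum, Finset.mul_sum, ← Finset.sum_add_distrib,
    ← Finset.sum_sub_distrib]
  refine Finset.sum_congr rfl fun j _ => ?_
  rw [hH, hβ2, hβ1, hβ0, hp1, hp0]
  have key := certificate_identity n (K + 2) t j
  simp only [H]
  linear_combination ((n.choose j : ℝ) ^ 2 * β j * p j) * key

/-- The cofactor of `t - 1` in the telescoping function. -/
noncomputable def teleCofactor (n K : ℕ) (t : ℝ) : ℝ :=
  poch (t - n - 1) n * poch t (K - n) / (poch t n * poch t (K + 2)) * certSum n K t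

lemma Rtilde_eq_innerSum {n m N : ℕ} (hN : 2 * n - m = N) (t : ℝ) :
    Rtilde n m t = poch (t - n) N / (poch t (n + 1) * poch t (N + 1)) * innerSum n N t := by
  have hf : (n.factorial : ℝ) ≠ 0 := by exact_mod_cast n.factorial_ne_zero
  rw [Rtilde, hN, ← Finset.sum_div, innerSum]
  field_simp

lemma Rtilde_telescopes {n m K : ℕ} (hn : 1 ≤ n) (hK : n ≤ K) (hm : m + K + 2 = 2 * n)
    {t : ℝ} (ht : 0 < t) :
    coeffZero (K + 2) * Rtilde n m t + coeffOne n (K + 2) * Rtilde n (m + 1) t +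
      coeffTwo n (K + 2) * Rtilde n (m + 2) t =
    (t + 1 - 1) * teleCofactor n K (t + 1) - (t - 1) * teleCofactor n K t := by
  rw [Rtilde_eq_innerSum (N := K + 2) (by omega), Rtilde_eq_innerSum (N := K + 1) (by omega),
    Rtilde_eq_innerSum (N := K) (by omega), teleCofactor, teleCofactor]
  have hrel := innerSum_relation n K hn hK t
  have e1 : poch (t - n) (K + 1) = poch (t - n) K * (t - n + K) := poch_succ _ _
  have e2 : poch (t - n) (K + 2) = poch (t - n) K * (t - n + K) * (t - n + K + 1) := by
    rw [poch_succ, poch_succ]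
    push_cast
    ring
  have e3 : poch (t - n - 1) n * (t - 1) * poch t (K - n) = (t - n - 1) * poch (t - n) K := by
    have h := poch_add (t - n - 1) n (1 + (K - n))
    rw [show n + (1 + (K - n)) = K + 1 by omega, poch_add _ 1, poch_succ_left _ K] at h
    rw [show poch (t - n - 1 + n) 1 = t - 1 by rw [poch_succ, poch_zero]; push_cast; ring,
      show t - (n : ℝ) - 1 + n + (1 : ℕ) = t by push_cast; ring,
      show t - (n : ℝ) - 1 + 1 = t - n by ring] at h
    linear_combination -h
  have e4 : poch (t + 1 - n - 1) n * t * poch (t + 1) (K - n) =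
      poch (t - n) K * (t - n + K) := by
    have h := poch_add (t - n) n (1 + (K - n))
    rw [show n + (1 + (K - n)) = K + 1 by omega, poch_add _ 1, e1] at h
    rw [show poch (t - n + n) 1 = t by rw [poch_succ, poch_zero]; push_cast; ring,
      show t - (n : ℝ) + n + (1 : ℕ) = t + 1 by push_cast; ring] at h
    rw [show t + 1 - (n : ℝ) - 1 = t - n by ring]
    linear_combination -h
  have d1 : poch t (n + 1) = poch t n * (t + n) := poch_succ _ _
  have d2 : poch t (K + 2 + 1) = poch t (K + 2) * (t + K + 2) := by
    rw [poch_succ]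
    push_cast
    ring
  have d3 : poch t (K + 2) = poch t (K + 1) * (t + K + 1) := by
    rw [poch_succ]
    push_cast
    ring
  have d4 : poch (t + 1) n = poch t n * (t + n) / t := by
    rw [← d1, poch_succ_left]
    field_simp
  have d5 : poch (t + 1) (K + 2) = poch t (K + 2) * (t + K + 2) / t := by
    rw [← d2, poch_succ_left t (K + 2)]
    field_simp
  have p1 := (poch_pos ht n).ne'
  have p2 := (poch_pos ht (K + 1)).ne'
  have p3 : t + n ≠ 0 := by positivity
  have p4 : t + K + 2 ≠ 0 := by positivity
  have p5 : t + K + 1 ≠ 0 := by positivity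
  have r1 : (t + 1 - 1) * (poch (t + 1 - n - 1) n * poch (t + 1) (K - n) /
      (poch (t + 1) n * poch (t + 1) (K + 2)) * certSum n K (t + 1)) =
      poch (t - n) K * (t - n + K) / (poch (t + 1) n * poch (t + 1) (K + 2)) *
        certSum n K (t + 1) := by
    rw [← e4]
    ring
  have r2 : (t - 1) * (poch (t - n - 1) n * poch t (K - n) /
      (poch t n * poch t (K + 2)) * certSum n K t) =
      (t - n - 1) * poch (t - n) K / (poch t n * poch t (K + 2)) * certSum n K t := by
    rw [← e3]
    ring
  rw [r1, r2, e2, e1, d4, d5, d2, d1, show K + 1 + 1 = K + 2 from rfl, d3]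
  field_simp
  linear_combination -(poch (t - n) K) * hrel

lemma hasDerivAt_poch {x : ℝ} {k : ℕ} (hx : ∀ i < k, x + i ≠ 0) :
    HasDerivAt (fun t => poch t k) (poch x k * ∑ i ∈ Finset.range k, 1 / (x + i)) x := by
  induction k with
  | zero => simpa [poch_zero] using hasDerivAt_const x (1 : ℝ)
  | succ k ih =>
    have h := (ih fun i hi => hx i (by omega)).mul ((hasDerivAt_id x).add_const (k : ℝ))
    have hk := hx k (by omega)
    simp only [poch_succ, Finset.sum_range_succ]
    refine h.congr_deriv ?_
    simp only [id]
    field_simp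

lemma S1_succ (N : ℕ) : S1 (N + 1) = S1 N + 1 / (N + 1) := by
  simp [S1, Finset.sum_range_succ]

lemma hasDerivAt_poch_one (k : ℕ) :
    HasDerivAt (fun t => poch t k) (poch 1 k * S1 k) 1 := by
  have h := hasDerivAt_poch (x := 1) (k := k) fun i _ => by positivity
  refine h.congr_deriv ?_
  simp only [S1, add_comm]

lemma poch_one (k : ℕ) : poch 1 k = k.factorial := by
  induction k with
  | zero => simp [poch_zero]
  | succ k ih =>
    rw [poch_succ, ih, Nat.factorial_succ]
    push_cast
    ring

lemma poch_neg (n : ℕ) : poch (-n) n = (-1) ^ n * n.factorial := by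
  rw [← poch_one, poch, ← Finset.prod_range_reflect, poch, ← Finset.card_range n,
    ← Finset.prod_const, Finset.card_range, ← Finset.prod_mul_distrib]
  refine Finset.prod_congr rfl fun i hi => ?_
  have hi := Finset.mem_range.1 hi
  rw [Nat.sub_sub, Nat.cast_sub (by omega)]
  push_cast
  ring

lemma hasDerivAt_poch_shifted_one (n : ℕ) :
    HasDerivAt (fun t : ℝ => poch (t - n - 1) n) (poch (-n) n * -S1 n) 1 := by
  have h := hasDerivAt_poch (x := 1 - n - 1) (k := n) fun i hi => by
    have : (i : ℝ) < n := by exact_mod_cast hi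
    linarith
  have hc : HasDerivAt (fun t : ℝ => t - n - 1) 1 1 :=
    ((hasDerivAt_id (1 : ℝ)).sub_const _).sub_const _
  have h2 := HasDerivAt.comp (h₂ := fun t => poch t n) (h := fun t : ℝ => t - n - 1) 1 h hc
  refine h2.congr_deriv ?_
  rw [mul_one, show (1 : ℝ) - n - 1 = -n by ring, S1, ← Finset.sum_range_reflect,
    ← Finset.sum_neg_distrib]
  congr 1
  refine Finset.sum_congr rfl fun i hi => ?_
  have hi := Finset.mem_range.1 hi
  rw [Nat.sub_sub, Nat.cast_sub (by omega)]
  push_cast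
  rw [← one_div_neg_eq_neg_one_div]
  congr 1
  ring

lemma sum_neg_one_pow_mul_choose_div (n : ℕ) :
    ∑ j ∈ Finset.range n, (-1 : ℝ) ^ j * n.choose (j + 1) / (j + 1) = S1 n := by
  induction n with
  | zero => simp [S1]
  | succ n ih =>
    rw [S1_succ, ← ih]
    have h1 : ∑ j ∈ Finset.range n, (-1 : ℝ) ^ j * n.choose (j + 1) / (j + 1) =
        ∑ j ∈ Finset.range (n + 1), (-1 : ℝ) ^ j * n.choose (j + 1) / (j + 1) := by
      simp [Finset.sum_range_succ]
    have h2 : ∑ j ∈ Finset.range (n + 1), (-1 : ℝ) ^ j * (n + 1).choose (j + 1) = 1 := by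
      have h := Int.alternating_sum_range_choose (n := n + 1)
      rw [Finset.sum_range_succ'] at h
      simp only [pow_succ, Nat.succ_ne_zero, if_false] at h
      have h' : ∑ j ∈ Finset.range (n + 1), (-1 : ℤ) ^ j * (n + 1).choose (j + 1) = 1 := by
        simp only [mul_neg, mul_one, neg_mul, Finset.sum_neg_distrib] at h
        simp at h
        linarith
      exact_mod_cast h'
    rw [h1, show (1 : ℝ) / (n + 1) = (∑ j ∈ Finset.range (n + 1),
      (-1 : ℝ) ^ j * (n + 1).choose (j + 1)) / (n + 1) by rw [h2], Finset.sum_div, ← Finset.sum_add_distrib]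
    refine Finset.sum_congr rfl fun j _ => ?_
    have h3 : ((n : ℝ) + 1) * n.choose j = (n + 1).choose (j + 1) * (j + 1) := by
      exact_mod_cast Nat.add_one_mul_choose_eq n j
    have h4 : ((n + 1).choose (j + 1) : ℝ) = n.choose j + n.choose (j + 1) := by
      exact_mod_cast Nat.choose_succ_succ n j
    have h5 : (n : ℝ) + 1 ≠ 0 := by positivity
    have h6 : (j : ℝ) + 1 ≠ 0 := by positivity
    field_simp
    rw [h4] at h3 ⊢
    linear_combination h3

lemma sum_neg_one_pow_mul_choose_mul_eval_div {n : ℕ} (hn : 1 ≤ n) (P : ℝ[X])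
    (hP : P.natDegree ≤ n) :
    ∑ j ∈ Finset.range n, (-1 : ℝ) ^ j * n.choose (j + 1) * P.eval (j + 1 : ℝ) / (j + 1) =
      P.eval 0 * S1 n + P.derivative.eval 0 := by
  set Q := P.divX with hQ
  have hdeg : Q.natDegree < n := by
    rw [hQ, natDegree_divX_eq_natDegree_tsub_one]
    omega
  have hdecomp : P = Q * X + C (P.eval 0) := by
    rw [← coeff_zero_eq_eval_zero]
    exact (divX_mul_X_add P).symm
  have hder : P.derivative.eval 0 = Q.eval 0 := by
    conv_lhs => rw [hdecomp]
    simp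
  have halt : ∑ j ∈ Finset.range n, (-1 : ℝ) ^ j * n.choose (j + 1) * Q.eval (j + 1 : ℝ) =
      Q.eval 0 := by
    have h := congrFun (Polynomial.fwdDiff_iter_eq_zero_of_degree_lt hdeg) 0
    rw [fwdDiff_iter_eq_sum_shift, Finset.sum_range_succ'] at h
    have hsgn : ∀ j ∈ Finset.range n, ((-1 : ℤ) ^ (n - (j + 1)) * n.choose (j + 1)) •
        Q.eval (0 + (j + 1) • (1 : ℝ)) =
        -(-1 : ℝ) ^ n * ((-1 : ℝ) ^ j * n.choose (j + 1) * Q.eval (j + 1 : ℝ)) := by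
      intro j hj
      have hj := Finset.mem_range.1 hj
      obtain ⟨r, rfl⟩ := Nat.exists_eq_add_of_lt hj
      rw [show j + r + 1 - (j + 1) = r by omega, zsmul_eq_mul]
      push_cast
      have : (-1 : ℝ) ^ (j + r + 1) * (-1) ^ j = -(-1) ^ r := by
        rw [pow_add, pow_add, mul_comm, ← mul_assoc, ← mul_assoc, ← mul_pow]
        simp
      simp only [zero_add, nsmul_eq_mul, mul_one]
      push_cast
      linear_combination (((j + r + 1).choose (j + 1) : ℝ) * Q.eval (j + 1 : ℝ)) * this
    rw [Finset.sum_congr rfl hsgn, ← Finset.mul_sum] at h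
    simp at h
    have hne : (-1 : ℝ) ^ n ≠ 0 := by simp
    apply mul_left_cancel₀ hne
    linarith
  rw [hder, ← sum_neg_one_pow_mul_choose_div, ← halt, Finset.mul_sum, ← Finset.sum_add_distrib]
  refine Finset.sum_congr rfl fun j _ => ?_
  have h6 : (j : ℝ) + 1 ≠ 0 := by positivity
  have hev : P.eval (j + 1 : ℝ) = Q.eval (j + 1 : ℝ) * (j + 1) + P.eval 0 := by
    conv_lhs => rw [hdecomp]
    simp
  rw [hev]
  field_simp
  ring

lemma poch_nat_add_one (a n : ℕ) : poch (a + 1) n = (a + n).choose n * n.factorial := by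
  have h := poch_add 1 a n
  rw [poch_one, poch_one, add_comm (1 : ℝ)] at h
  have h2 : ((a + n).choose n : ℝ) * a.factorial * n.factorial = (a + n).factorial := by
    exact_mod_cast Nat.add_choose_mul_factorial_mul_factorial a n
  have hne : (a.factorial : ℝ) ≠ 0 := by exact_mod_cast a.factorial_ne_zero
  apply mul_left_cancel₀ hne
  linear_combination -h - h2

lemma S1_add (a n : ℕ) :
    S1 (a + n) = S1 a + ∑ i ∈ Finset.range n, (1 : ℝ) / (a + 1 + i) := by
  simp only [S1, Finset.sum_range_add]
  congr 1
  refine Finset.sum_congr rfl fun i _ => ?_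
  push_cast
  congr 1
  ring

/-- The polynomial whose value at `x` is `poch (x + a) k`. -/
noncomputable def pochPoly (a : ℝ) (k : ℕ) : ℝ[X] := ∏ i ∈ Finset.range k, (X + C (a + i))

lemma eval_pochPoly (a : ℝ) (k : ℕ) (x : ℝ) : (pochPoly a k).eval x = poch (x + a) k := by
  simp [pochPoly, poch, eval_prod, add_assoc]

lemma natDegree_pochPoly (a : ℝ) (k : ℕ) : (pochPoly a k).natDegree = k := by
  rw [pochPoly, natDegree_prod_of_monic _ _ fun i _ => monic_X_add_C _]
  simp only [natDegree_X_add_C, Finset.sum_const, Finset.card_range, smul_eq_mul, mul_one]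

lemma sum_neg_one_pow_mul_choose_mul_choose_div {n : ℕ} (hn : 1 ≤ n) (a : ℕ) :
    ∑ j ∈ Finset.range n,
        (-1 : ℝ) ^ j * n.choose (j + 1) * (a + n + (j + 1)).choose n / (j + 1) =
      (a + n).choose n * (S1 n + S1 (a + n) - S1 a) := by
  have h := sum_neg_one_pow_mul_choose_mul_eval_div hn (pochPoly (a + 1) n)
    (natDegree_pochPoly _ _).le
  have hder : (pochPoly (a + 1) n).derivative.eval 0 =
      poch (a + 1) n * (S1 (a + n) - S1 a) := by
    have h1 := (pochPoly (a + 1) n).hasDerivAt 0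
    have h2 : HasDerivAt (fun t => poch t n)
        (poch (0 + (a + 1)) n * ∑ i ∈ Finset.range n, 1 / (0 + ((a : ℝ) + 1) + i))
        (0 + ((a : ℝ) + 1)) := hasDerivAt_poch fun i _ => by positivity
    have h3 := h2.comp_add_const 0 ((a : ℝ) + 1)
    simp only [eval_pochPoly] at h1
    rw [h1.unique h3, zero_add, S1_add, add_sub_cancel_left]
  have hf : (n.factorial : ℝ) ≠ 0 := by exact_mod_cast n.factorial_ne_zero
  rw [hder, eval_pochPoly, zero_add, poch_nat_add_one] at h
  apply mul_left_cancel₀ hf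
  rw [Finset.mul_sum]
  refine Eq.trans (Finset.sum_congr rfl fun j _ => ?_) (h.trans (by ring))
  rw [eval_pochPoly, show (j : ℝ) + 1 + (a + 1) = ((a + (j + 1) : ℕ) : ℝ) + 1 by push_cast; ring,
    poch_nat_add_one, show a + (j + 1) + n = a + n + (j + 1) by ring]
  ring

lemma hasDerivAt_poch_sub_one {n j : ℕ} (hj : j < n) :
    HasDerivAt (fun t : ℝ => poch (t - (j + 1 : ℕ)) n)
      ((-1) ^ j * j.factorial * (n - 1 - j).factorial) 1 := by
  have hfac : (fun t : ℝ => poch (t - (j + 1 : ℕ)) n) =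
      fun t => poch (t - j - 1) j * (t - 1) * poch t (n - 1 - j) := by
    funext t
    conv_lhs => rw [show n = j + (1 + (n - 1 - j)) by omega]
    rw [poch_add, poch_add, poch_succ, poch_zero]
    push_cast
    rw [show t - ((j : ℝ) + 1) + j + 1 = t by ring, show t - ((j : ℝ) + 1) = t - j - 1 by ring]
    ring
  rw [hfac]
  refine (((hasDerivAt_poch_shifted_one j).fun_mul ((hasDerivAt_id (1 : ℝ)).sub_const 1)).fun_mul
    (hasDerivAt_poch_one (n - 1 - j))).congr_deriv ?_
  rw [show (1 : ℝ) - j - 1 = -j by ring, poch_one, poch_neg]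
  simp

lemma innerSum_one (n N : ℕ) :
    innerSum n N 1 = N.choose n * n.factorial := by
  rw [innerSum, Finset.sum_range_succ', Finset.sum_eq_zero fun j hj => ?_]
  · simp [poch_one]
  · have hj := Finset.mem_range.1 hj
    have : poch (1 - ((j + 1 : ℕ) : ℝ)) n = 0 :=
      Finset.prod_eq_zero (Finset.mem_range.2 hj) (by push_cast; ring)
    rw [this, mul_zero]

lemma hasDerivAt_innerSum_one {n : ℕ} (hn : 1 ≤ n) (a : ℕ) :
    HasDerivAt (innerSum n (a + n))
      ((a + n).choose n * n.factorial * (2 * S1 n + S1 (a + n) - S1 a)) 1 := by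
  have hfun : innerSum n (a + n) = fun t : ℝ => (∑ j ∈ Finset.range n,
      (n.choose (j + 1) : ℝ) ^ 2 * ((a + n + (j + 1)).choose n : ℝ) * poch (t - (j + 1 : ℕ)) n) +
      ((a + n).choose n : ℝ) * poch t n := by
    funext t
    rw [innerSum, Finset.sum_range_succ']
    simp
  rw [hfun]
  refine ((HasDerivAt.fun_sum fun j hj =>
    (hasDerivAt_poch_sub_one (Finset.mem_range.1 hj)).const_mul _).fun_add
    ((hasDerivAt_poch_one n).const_mul _)).congr_deriv ?_
  have hterm : ∀ j ∈ Finset.range n,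
      (n.choose (j + 1) : ℝ) ^ 2 * ((a + n + (j + 1)).choose n : ℝ) *
        ((-1) ^ j * j.factorial * (n - 1 - j).factorial) =
      n.factorial * ((-1 : ℝ) ^ j * n.choose (j + 1) * (a + n + (j + 1)).choose n / (j + 1)) := by
    intro j hj
    have hj := Finset.mem_range.1 hj
    have h : (n.choose (j + 1) : ℝ) * ((j + 1) * j.factorial) * (n - 1 - j).factorial =
        n.factorial := by
      have h := Nat.choose_mul_factorial_mul_factorial (n := n) (k := j + 1) hj
      rw [Nat.factorial_succ, show n - (j + 1) = n - 1 - j by omega] at h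
      exact_mod_cast h
    have h6 : (j : ℝ) + 1 ≠ 0 := by positivity
    field_simp
    linear_combination ((n.choose (j + 1) : ℝ) * (a + n + (j + 1)).choose n) * h
  rw [Finset.sum_congr rfl hterm, ← Finset.mul_sum,
    sum_neg_one_pow_mul_choose_mul_choose_div hn, poch_one]
  ring

lemma hasDerivAt_teleCofactor_one {n K : ℕ} (hn : 1 ≤ n) (hK : n ≤ K) :
    HasDerivAt (teleCofactor n K) 0 1 := by
  obtain ⟨a, rfl⟩ := Nat.exists_eq_add_of_le' hK
  have hq1 : HasDerivAt (fun t => certOne n ((a + n : ℕ) + 2) t) (certOne n ((a + n : ℕ) + 2) 1 -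
      certOne n ((a + n : ℕ) + 2) 0) 1 := by
    simp only [certOne]
    refine ((((hasDerivAt_id (1 : ℝ)).add_const _).sub_const _).sub_const _ |>.const_mul
      _).congr_deriv ?_
    ring
  have hq2 : HasDerivAt (fun t => certTwo n ((a + n : ℕ) + 2) t) (certTwo n ((a + n : ℕ) + 2) 1 -
      certTwo n ((a + n : ℕ) + 2) 0) 1 := by
    simp only [certTwo]
    refine (((hasDerivAt_id (1 : ℝ)).const_mul _).add_const _ |>.const_mul _).congr_deriv ?_
    ring
  have hs1 := hasDerivAt_innerSum_one hn (a + 1)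
  have hs0 := hasDerivAt_innerSum_one hn a
  rw [show a + 1 + n = a + n + 1 by ring] at hs1
  have hcert := (hq1.fun_mul hs1).fun_add (hq2.fun_mul hs0)
  have hnum := (hasDerivAt_poch_shifted_one n).fun_mul (hasDerivAt_poch_one (a + n - n))
  have hden := (hasDerivAt_poch_one n).fun_mul (hasDerivAt_poch_one (a + n + 2))
  have hp1 : poch 1 n ≠ 0 := (poch_pos one_pos n).ne'
  have hp2 : poch 1 (a + n + 2) ≠ 0 := (poch_pos one_pos _).ne'
  refine ((hnum.fun_div hden (mul_ne_zero hp1 hp2)).fun_mul hcert).congr_deriv ?_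
  have hchoose : ((a + n + 1).choose n : ℝ) = (a + n + 1) * (a + n).choose n / (a + 1) := by
    have h := Nat.choose_mul_succ_eq (a + n) n
    rw [show a + n + 1 - n = a + 1 by omega] at h
    have h' : ((a + n).choose n : ℝ) * (a + n + 1) = (a + n + 1).choose n * (a + 1) := by
      exact_mod_cast h
    have : (a : ℝ) + 1 ≠ 0 := by positivity
    field_simp
    linear_combination -h'
  rw [innerSum_one, innerSum_one, hchoose, S1_succ (a + n + 1), S1_succ (a + n), S1_succ a,
    Nat.add_sub_cancel, show (1 : ℝ) - n - 1 = -n by ring]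
  have h1 : (a : ℝ) + 1 ≠ 0 := by positivity
  have h2 : (a : ℝ) + n + 1 ≠ 0 := by positivity
  have h3 : (a : ℝ) + n + 2 ≠ 0 := by positivity
  have h3' : (a : ℝ) + n + 1 + 1 ≠ 0 := by positivity
  simp only [certOne, certTwo]
  push_cast
  field_simp
  ring

/-- `f` agrees on `(0, ∞)` with a quotient of polynomials, with nonvanishing denominator, that is
`O(t ^ (-k))` at infinity. -/
def IsRationalDecay (k : ℕ) (f : ℝ → ℝ) : Prop :=
  ∃ P Q : ℝ[X], (∀ t, 0 < t → Q.eval t ≠ 0) ∧ (∀ t, 0 < t → f t = P.eval t / Q.eval t) ∧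
    P.natDegree + k ≤ Q.natDegree

namespace IsRationalDecay

variable {k : ℕ} {f : ℝ → ℝ}

lemma hasDerivAt_of_eq {P Q : ℝ[X]} (hQ : ∀ t, 0 < t → Q.eval t ≠ 0)
    (hf : ∀ t, 0 < t → f t = P.eval t / Q.eval t) {t : ℝ} (ht : 0 < t) :
    HasDerivAt f ((derivative P * Q - P * derivative Q).eval t / (Q ^ 2).eval t) t := by
  have h := (P.hasDerivAt t).fun_div (Q.hasDerivAt t) (hQ t ht)
  refine (h.congr_of_eventuallyEq ?_).congr_deriv (by simp)
  filter_upwards [lt_mem_nhds ht] with s hs using hf s hs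

lemma differentiableAt (h : IsRationalDecay k f) {t : ℝ} (ht : 0 < t) :
    DifferentiableAt ℝ f t := by
  obtain ⟨P, Q, hQ, hf, -⟩ := h
  exact (hasDerivAt_of_eq hQ hf ht).differentiableAt

lemma deriv (h : IsRationalDecay k f) : IsRationalDecay k (deriv f) := by
  obtain ⟨P, Q, hQ, hf, hd⟩ := h
  refine ⟨derivative P * Q - P * derivative Q, Q ^ 2, fun t ht => by simpa using hQ t ht,
    fun t ht => (hasDerivAt_of_eq hQ hf ht).deriv, ?_⟩
  have h1 : (derivative P * Q - P * derivative Q).natDegree ≤ P.natDegree + Q.natDegree := by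
    have hP := natDegree_derivative_le P
    have hQ := natDegree_derivative_le Q
    refine (natDegree_sub_le _ _).trans (max_le ?_ ?_)
    · exact natDegree_mul_le.trans (by omega)
    · exact natDegree_mul_le.trans (by omega)
  rw [natDegree_pow]
  omega

lemma deriv_of_zero (h : IsRationalDecay 0 f) : IsRationalDecay 1 (_root_.deriv f) := by
  obtain ⟨P, Q, hQ, hf, hd⟩ := h
  rcases Nat.eq_zero_or_pos Q.natDegree with h0 | hpos
  · refine ⟨0, X, fun t ht => by simpa using ht.ne', fun t ht => ?_, by simp⟩
    rw [(hasDerivAt_of_eq hQ hf ht).deriv, derivative_of_natDegree_zero h0,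
      derivative_of_natDegree_zero (by omega : P.natDegree = 0)]
    simp
  refine ⟨derivative P * Q - P * derivative Q, Q ^ 2, fun t ht => by simpa using hQ t ht,
    fun t ht => (hasDerivAt_of_eq hQ hf ht).deriv, ?_⟩
  have h1 : (derivative P * Q - P * derivative Q).natDegree ≤ 2 * Q.natDegree - 1 := by
    have hP := natDegree_derivative_le P
    have hQ := natDegree_derivative_le Q
    refine (natDegree_sub_le _ _).trans (max_le ?_ ?_)
    · exact natDegree_mul_le.trans (by omega)
    · exact natDegree_mul_le.trans (by omega)
  rw [natDegree_pow]
  omega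

lemma tendsto_zero (h : IsRationalDecay k f) (hk : 1 ≤ k) :
    Filter.Tendsto f Filter.atTop (nhds 0) := by
  obtain ⟨P, Q, hQ, hf, hd⟩ := h
  have hdeg : P.degree < Q.degree := degree_lt_degree (by omega)
  refine (div_tendsto_atTop_zero_of_degree_lt P Q hdeg).congr' ?_
  filter_upwards [Filter.eventually_gt_atTop 0] with t ht using (hf t ht).symm

lemma summable (h : IsRationalDecay k f) (hk : 2 ≤ k) :
    Summable fun ν : ℕ => f (1 + ν) := by
  obtain ⟨P, Q, hQ, hf, hd⟩ := h
  have hQ0 : Q ≠ 0 := by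
    rintro rfl
    simp at hd
    omega
  have hX : (P * X ^ 2).degree ≤ Q.degree := by
    rw [degree_eq_natDegree hQ0]
    refine degree_le_of_natDegree_le (natDegree_mul_le.trans ?_)
    simp
    omega
  have hO := isBigO_atTop_of_degree_le (P * X ^ 2) Q hX
  have hO2 : f =O[Filter.atTop] fun t => (t ^ 2)⁻¹ := by
    have := hO.mul (Asymptotics.isBigO_refl (fun t : ℝ => (t ^ 2)⁻¹ * (Q.eval t)⁻¹) Filter.atTop)
    refine this.congr' ?_ ?_
    · filter_upwards [Filter.eventually_gt_atTop 0] with t ht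
      have := hQ t ht
      rw [hf t ht]
      simp
      field_simp
    · filter_upwards [Filter.eventually_gt_atTop 0] with t ht
      have := hQ t ht
      field_simp
  have hnat : Filter.Tendsto (fun ν : ℕ => (1 : ℝ) + ν) Filter.atTop Filter.atTop :=
    Filter.tendsto_atTop_add_const_left _ _ tendsto_natCast_atTop_atTop
  refine summable_of_isBigO_nat ?_ (hO2.comp_tendsto hnat)
  have hs := (summable_nat_add_iff 1).2 (Real.summable_nat_pow_inv.2 one_lt_two)
  refine hs.congr fun ν => ?_
  simp [add_comm]

end IsRationalDecay

lemma deriv_relation {f₀ f₁ f₂ G : ℝ → ℝ} {c₀ c₁ c₂ : ℝ}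
    (h₀ : ∀ t, 0 < t → DifferentiableAt ℝ f₀ t) (h₁ : ∀ t, 0 < t → DifferentiableAt ℝ f₁ t)
    (h₂ : ∀ t, 0 < t → DifferentiableAt ℝ f₂ t) (hG : ∀ t, 0 < t → DifferentiableAt ℝ G t)
    (h : ∀ t, 0 < t → c₀ * f₀ t + c₁ * f₁ t + c₂ * f₂ t = G (t + 1) - G t) :
    ∀ t, 0 < t → c₀ * deriv f₀ t + c₁ * deriv f₁ t + c₂ * deriv f₂ t =
      deriv G (t + 1) - deriv G t := by
  intro t ht
  have hl := (((h₀ t ht).hasDerivAt.const_mul c₀).fun_add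
    ((h₁ t ht).hasDerivAt.const_mul c₁)).fun_add ((h₂ t ht).hasDerivAt.const_mul c₂)
  have hr := ((hG (t + 1) (by linarith)).hasDerivAt.comp_add_const t 1).fun_sub
    (hG t ht).hasDerivAt
  refine hl.unique (hr.congr_of_eventuallyEq ?_)
  filter_upwards [lt_mem_nhds ht] with s hs using h s hs

/-- The polynomial `innerSum n N`. -/
noncomputable def innerSumPoly (n N : ℕ) : ℝ[X] :=
  ∑ j ∈ Finset.range (n + 1), C ((n.choose j : ℝ) ^ 2 * ((N + j).choose n : ℝ)) * pochPoly (-j) n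

lemma eval_innerSumPoly (n N : ℕ) (t : ℝ) : (innerSumPoly n N).eval t = innerSum n N t := by
  simp [innerSumPoly, innerSum, eval_finsetSum, eval_pochPoly, sub_eq_add_neg]

lemma natDegree_innerSumPoly_le (n N : ℕ) : (innerSumPoly n N).natDegree ≤ n :=
  natDegree_sum_le_of_forall_le _ _ fun _ _ =>
    (natDegree_C_mul_le _ _).trans (natDegree_pochPoly _ _).le

lemma eval_pochPoly_zero_mul_ne_zero (k l : ℕ) (t : ℝ) (ht : 0 < t) :
    (pochPoly 0 k * pochPoly 0 l).eval t ≠ 0 := by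
  rw [eval_mul, eval_pochPoly, eval_pochPoly, add_zero]
  exact mul_ne_zero (poch_pos ht k).ne' (poch_pos ht l).ne'

lemma natDegree_pochPoly_mul (a b : ℝ) (k l : ℕ) :
    (pochPoly a k * pochPoly b l).natDegree = k + l := by
  have hm (a : ℝ) (k : ℕ) : (pochPoly a k).Monic := monic_prod_of_monic _ _ fun i _ =>
    monic_X_add_C _
  rw [(hm a k).natDegree_mul (hm b l), natDegree_pochPoly, natDegree_pochPoly]

lemma isRationalDecay_Rtilde (n m : ℕ) : IsRationalDecay 2 (Rtilde n m) := by
  refine ⟨pochPoly (-n) (2 * n - m) * innerSumPoly n (2 * n - m),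
    pochPoly 0 (n + 1) * pochPoly 0 (2 * n - m + 1), eval_pochPoly_zero_mul_ne_zero _ _,
    fun t _ => ?_, ?_⟩
  · rw [Rtilde_eq_innerSum rfl, eval_mul, eval_mul, eval_pochPoly, eval_pochPoly, eval_pochPoly,
      eval_innerSumPoly, add_zero, ← sub_eq_add_neg]
    ring
  · have h1 := natDegree_mul_le (p := pochPoly (-n) (2 * n - m)) (q := innerSumPoly n (2 * n - m))
    have h2 := natDegree_innerSumPoly_le n (2 * n - m)
    rw [natDegree_pochPoly] at h1
    rw [natDegree_pochPoly_mul]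
    omega

/-- The polynomial `certSum n K`. -/
noncomputable def certSumPoly (n K : ℕ) : ℝ[X] :=
  (C (certOne n (K + 2) 1 - certOne n (K + 2) 0) * X + C (certOne n (K + 2) 0)) *
      innerSumPoly n (K + 1) +
    (C (certTwo n (K + 2) 1 - certTwo n (K + 2) 0) * X + C (certTwo n (K + 2) 0)) *
      innerSumPoly n K

lemma eval_certSumPoly (n K : ℕ) (t : ℝ) : (certSumPoly n K).eval t = certSum n K t := by
  simp only [certSumPoly, certSum, eval_add, eval_mul, eval_innerSumPoly, eval_C, eval_X,
    certOne, certTwo]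
  ring

lemma natDegree_certSumPoly_le (n K : ℕ) : (certSumPoly n K).natDegree ≤ n + 1 := by
  have hlin (a b : ℝ) (N : ℕ) : ((C a * X + C b) * innerSumPoly n N).natDegree ≤ n + 1 := by
    have h1 := natDegree_mul_le (p := C a * X + C b) (q := innerSumPoly n N)
    have h2 := natDegree_innerSumPoly_le n N
    have h3 := natDegree_linear_le (a := a) (b := b)
    omega
  exact natDegree_add_le_of_degree_le (hlin _ _ _) (hlin _ _ _)

lemma isRationalDecay_teleCofactor {n K : ℕ} (hK : n ≤ K) :
    IsRationalDecay 1 (teleCofactor n K) ∧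
      IsRationalDecay 0 (fun t => (t - 1) * teleCofactor n K t) := by
  have heq (t : ℝ) : teleCofactor n K t =
      (pochPoly (-n - 1) n * pochPoly 0 (K - n) * certSumPoly n K).eval t /
        (pochPoly 0 n * pochPoly 0 (K + 2)).eval t := by
    simp only [teleCofactor, eval_mul, eval_pochPoly, eval_certSumPoly, add_zero]
    rw [show t + (-(n : ℝ) - 1) = t - n - 1 by ring]
    ring
  have hdeg := natDegree_mul_le (p := pochPoly (-n - 1) n * pochPoly 0 (K - n))
    (q := certSumPoly n K)
  have hcert := natDegree_certSumPoly_le n K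
  rw [natDegree_pochPoly_mul] at hdeg
  refine ⟨⟨pochPoly (-n - 1) n * pochPoly 0 (K - n) * certSumPoly n K,
    pochPoly 0 n * pochPoly 0 (K + 2), eval_pochPoly_zero_mul_ne_zero _ _, fun t _ => heq t, ?_⟩,
    ⟨(X - C 1) * (pochPoly (-n - 1) n * pochPoly 0 (K - n) * certSumPoly n K),
      pochPoly 0 n * pochPoly 0 (K + 2), eval_pochPoly_zero_mul_ne_zero _ _, fun t _ => ?_, ?_⟩⟩
  · rw [natDegree_pochPoly_mul]
    omega
  · beta_reduce
    rw [heq, eval_mul (p := X - C 1), mul_div_assoc, eval_sub, eval_X, eval_C]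
  · have h := natDegree_mul_le (p := X - C (1 : ℝ))
      (q := pochPoly (-n - 1) n * pochPoly 0 (K - n) * certSumPoly n K)
    rw [natDegree_X_sub_C] at h
    rw [natDegree_pochPoly_mul]
    omega

lemma deriv_deriv_sub_one_mul_eq_zero {h : ℝ → ℝ} {k : ℕ} (hh : IsRationalDecay k h)
    (h1 : deriv h 1 = 0) : deriv (deriv fun t => (t - 1) * h t) 1 = 0 := by
  have hfirst : deriv (fun t => (t - 1) * h t) =ᶠ[nhds 1]
      fun t => h t + (t - 1) * deriv h t := by
    filter_upwards [lt_mem_nhds one_pos] with t ht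
    rw [(((hasDerivAt_id' t).sub_const 1).fun_mul (hh.differentiableAt ht).hasDerivAt).deriv]
    simp
  rw [hfirst.deriv_eq, ((hh.differentiableAt one_pos).hasDerivAt.fun_add
    (((hasDerivAt_id' (1 : ℝ)).sub_const 1).fun_mul
      (hh.deriv.differentiableAt one_pos).hasDerivAt)).deriv]
  simp [h1]

/-- The second-order recurrence in `m` satisfied by `Z_r(n,m)` for `0 ≤ m ≤ n - 2`. -/
theorem Zr_recurrence (n m : ℕ) (hmn : m + 2 ≤ n) :
    (2 * (n : ℝ) - m) ^ 5 * Zr n m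
      - (4 * (n : ℝ) - 2 * m - 1) *
        (6 * (n : ℝ) ^ 4 - 24 * (n : ℝ) ^ 3 * m + 22 * (n : ℝ) ^ 2 * (m : ℝ) ^ 2
          - 8 * (n : ℝ) * (m : ℝ) ^ 3 + (m : ℝ) ^ 4 - 24 * (n : ℝ) ^ 3
          + 30 * (n : ℝ) ^ 2 * m - 14 * (n : ℝ) * (m : ℝ) ^ 2 + 2 * (m : ℝ) ^ 3
          + 8 * (n : ℝ) ^ 2 - 10 * (n : ℝ) * m + 2 * (m : ℝ) ^ 2 - 4 * (n : ℝ) + m) *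
        Zr n (m + 1)
      - (2 * (n : ℝ) - m - 1) ^ 3 * (4 * (n : ℝ) - m) * ((m : ℝ) + 2) * Zr n (m + 2) = 0 := by
  obtain ⟨K, hK⟩ : ∃ K, m + K + 2 = 2 * n := ⟨2 * n - m - 2, by omega⟩
  have hn : 1 ≤ n := by omega
  have hnK : n ≤ K := by omega
  have hmr : (m : ℝ) = 2 * n - (K + 2) := by
    have : ((m + K + 2 : ℕ) : ℝ) = (2 * n : ℕ) := by rw [hK]
    push_cast at this
    linarith
  obtain ⟨hcof, hG⟩ := isRationalDecay_teleCofactor hnK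
  set G : ℝ → ℝ := fun t => (t - 1) * teleCofactor n K t with hGdef
  have hR (i : ℕ) := isRationalDecay_Rtilde n i
  have hd1 := deriv_relation (fun t ht => (hR m).differentiableAt ht)
    (fun t ht => (hR (m + 1)).differentiableAt ht) (fun t ht => (hR (m + 2)).differentiableAt ht)
    (fun t ht => hG.differentiableAt ht) fun t ht => Rtilde_telescopes hn hnK hK ht
  have hd2 := deriv_relation (fun t ht => (hR m).deriv.differentiableAt ht)
    (fun t ht => (hR (m + 1)).deriv.differentiableAt ht)
    (fun t ht => (hR (m + 2)).deriv.differentiableAt ht)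
    (fun t ht => hG.deriv.differentiableAt ht) hd1
  have hG1 : deriv (deriv G) 1 = 0 :=
    deriv_deriv_sub_one_mul_eq_zero hcof (hasDerivAt_teleCofactor_one hn hnK).deriv
  have hlim : Filter.Tendsto (fun ν : ℕ => deriv (deriv G) (1 + ν)) Filter.atTop (nhds 0) :=
    (hG.deriv_of_zero.deriv.tendsto_zero le_rfl).comp
      (Filter.tendsto_atTop_add_const_left _ _ tendsto_natCast_atTop_atTop)
  have hs (i : ℕ) := ((hR i).deriv.deriv.summable le_rfl).hasSum
  have hsum := (((hs m).mul_left (coeffZero (K + 2))).add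
    ((hs (m + 1)).mul_left (coeffOne n (K + 2)))).add
    ((hs (m + 2)).mul_left (coeffTwo n (K + 2)))
  have hpart (M : ℕ) : ∑ ν ∈ Finset.range M,
      (coeffZero (K + 2) * deriv (deriv (Rtilde n m)) (1 + ν) +
        coeffOne n (K + 2) * deriv (deriv (Rtilde n (m + 1))) (1 + ν) +
        coeffTwo n (K + 2) * deriv (deriv (Rtilde n (m + 2))) (1 + ν)) =
      deriv (deriv G) (1 + M) := by
    have htel := Finset.sum_range_sub (fun ν : ℕ => deriv (deriv G) (1 + ν)) M
    rw [Nat.cast_zero, add_zero, hG1, sub_zero] at htel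
    rw [← htel]
    refine Finset.sum_congr rfl fun ν _ => ?_
    rw [hd2 (1 + ν) (by positivity)]
    push_cast
    rw [add_assoc]
  have hzero := tendsto_nhds_unique hsum.tendsto_sum_nat (hlim.congr fun M => (hpart M).symm)
  simp only [coeffZero, coeffOne, coeffTwo] at hzero
  rw [Zr, Zr, Zr, hmr]
  linear_combination (1 / 6) * hzero
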